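/- For every n ≥ 1, every 0 ≤ k ≤ n and every P ∈ ℤⁿ: Z(z(P;k), q(P;k), p(P;k), b(P;k)) = P − V_{k−1}, B(z(P;k), q(P;k), p(P;k), b(P;k)) = P + V_{k−1}, Z(z*(P;k), q(P;k), p(P;k), b*(P;k)) = P − V_k, and B(z*(P;k), q(P;k), p(P;k), b*(P;k)) = P + V_k. Consequently, for every distributive D(ℤⁿ)-filtration (F_p) of an ungraded chain complex (C,d) and every 0 ≤ k ≤ n−1, the S-terms S^{p(P;k), z*(P;k)}_{b*(P;k), q(P;k)} and S^{p(P;k+1), z(P;k+1)}_{b(P;k+1), q(P;k+1)} are isomorphic. -/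

import Mathlib

open Function

/-- The numerator subgroup `F_p ∩ d⁻¹(F_z)` of an S-term. -/
abbrev Snum {C : Type*} [AddCommGroup C] (d : C →+ C) (Fp Fz : AddSubgroup C) :
    AddSubgroup C := Fp ⊓ Fz.comap d

/-- The denominator subgroup `d(F_b) + F_q` of an S-term. -/
abbrev Sden {C : Type*} [AddCommGroup C] (d : C →+ C) (Fb Fq : AddSubgroup C) :
    AddSubgroup C := Fb.map d ⊔ Fq

/-- The S-term `S^{pz}_{bq} = (F_p ∩ d⁻¹(F_z)) / ((F_p ∩ d⁻¹(F_z)) ∩ (d(F_b) + F_q))`. -/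
abbrev Sterm {C : Type*} [AddCommGroup C] (d : C →+ C) (Fp Fz Fb Fq : AddSubgroup C) :=
  ↥(Snum d Fp Fz) ⧸ (Sden d Fb Fq).addSubgroupOf (Snum d Fp Fz)

/-- The class of an element `x ∈ F_p ∩ d⁻¹(F_z)` in the S-term. -/
def Scls {C : Type*} [AddCommGroup C] (d : C →+ C) (Fp Fz Fb Fq : AddSubgroup C)
    {x : C} (hx : x ∈ Snum d Fp Fz) : Sterm d Fp Fz Fb Fq :=
  QuotientAddGroup.mk ⟨x, hx⟩

/-- `ℤ̄ = ℤ ∪ {−∞, +∞}`. -/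
abbrev ZBar := WithBot (WithTop ℤ)

/-- A single step of a path inside `A`: both endpoints are in `A` and they are
comparable. -/
def StepIn {V : Type*} [Preorder V] (A : Set V) (a b : V) : Prop :=
  a ∈ A ∧ b ∈ A ∧ (a ≤ b ∨ b ≤ a)

/-- `x` and `y` are joined by a path inside `A` whose consecutive points are comparable. -/
def ReachIn {V : Type*} [Preorder V] (A : Set V) : V → V → Prop :=
  Relation.ReflTransGen (StepIn A)

/-- `Z(z,q,p,b)`: the union of the connected components of `p∖z` that intersect `p∖q`. -/
def Zset {V : Type*} [Preorder V] (z q p b : Set V) : Set V :=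
  {x | x ∈ p \ z ∧ ∃ y ∈ p \ q, ReachIn (p \ z) x y}

/-- `B(z,q,p,b)`: the union of the connected components of `b∖q` that intersect `p∖q`. -/
def Bset {V : Type*} [Preorder V] (z q p b : Set V) : Set V :=
  {x | x ∈ b \ q ∧ ∃ y ∈ p \ q, ReachIn (b \ q) x y}

/-- Standard basis vectors `e_k` of `ℤⁿ` (1-indexed), with the conventions `e_0 = 0` and
`e_{−1} = −e_n`. -/
def stdE (n : ℕ) (k : ℤ) : Fin n → ℤ := fun i =>
  if ((i : ℕ) : ℤ) + 1 = k then 1 else if k = -1 ∧ (i : ℕ) + 1 = n then -1 else 0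

/-- Lexicographic order on `ℤⁿ`. -/
def lexLe {n : ℕ} (x y : Fin n → ℤ) : Prop :=
  x = y ∨ ∃ i : Fin n, (∀ j : Fin n, j < i → x j = y j) ∧ x i < y i

/-- The automorphism `φ_k(X) = (x_{k+1},…,x_n, Σ_{i=1}^k x_i, Σ_{i=2}^k x_i, …, x_k)`
of `ℤⁿ` (here written for 0-indexed coordinates). -/
def phiAut (n k : ℕ) (X : Fin n → ℤ) : Fin n → ℤ := fun j =>
  if h : (j : ℕ) + k < n then X ⟨(j : ℕ) + k, h⟩
  else ∑ i : Fin n, if (j : ℕ) + k - n ≤ (i : ℕ) ∧ (i : ℕ) < k then X i else 0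

/-- The downset `T^k_P = {X ∈ ℤⁿ : φ_k(X) ≤lex φ_k(P)}`. -/
def Tset (n k : ℕ) (P : Fin n → ℤ) : Set (Fin n → ℤ) :=
  {X | lexLe (phiAut n k X) (phiAut n k P)}

/-- `p(P;k) := T^k_P`. -/
def pSec (n k : ℕ) (P : Fin n → ℤ) : Set (Fin n → ℤ) := Tset n k P

/-- `q(P;k) := T^k_P ∖ {P}`. -/
def qSec (n k : ℕ) (P : Fin n → ℤ) : Set (Fin n → ℤ) := Tset n k P \ {P}

/-- `z(P;k) := T^k_{P−e_k}`. -/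
def zSec (n k : ℕ) (P : Fin n → ℤ) : Set (Fin n → ℤ) := Tset n k (P - stdE n (k : ℤ))

/-- `b(P;k) := T^k_{P+e_{k−1}}`. -/
def bSec (n k : ℕ) (P : Fin n → ℤ) : Set (Fin n → ℤ) := Tset n k (P + stdE n ((k : ℤ) - 1))

/-- `z*(P;k) := z(P;k) ∖ {P−e_k}`. -/
def zsSec (n k : ℕ) (P : Fin n → ℤ) : Set (Fin n → ℤ) := zSec n k P \ {P - stdE n (k : ℤ)}

/-- `b*(P;k) := b(P;k) ∪ {P+e_k}`. -/
def bsSec (n k : ℕ) (P : Fin n → ℤ) : Set (Fin n → ℤ) := bSec n k P ∪ {P + stdE n (k : ℤ)}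

/-- The sets `V_{k−1}` with index shifted by one: `Vm n 0 = V_{−1} = ∅`,
`Vm n 1 = V_0 = {0}`, and `Vm n (k+1) = V_k = V_{k−1} ∪ (e_k − V_{k−1})`. -/
def Vm (n : ℕ) : ℕ → Set (Fin n → ℤ)
  | 0 => ∅
  | 1 => {0}
  | (j + 2) => Vm n (j + 1) ∪ (fun v => stdE n ((j : ℤ) + 1) - v) '' Vm n (j + 1)

namespace St7


theorem quot_iso {C : Type*} [AddCommGroup C] (N D N0 D0 : AddSubgroup C) (h1 : N0 ≤ N)
    (h2 : N ≤ N0 ⊔ D) (h3 : ∀ x ∈ N0, x ∈ D ↔ x ∈ D0) :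
    Nonempty ((↥N ⧸ D.addSubgroupOf N) ≃+ (↥N0 ⧸ D0.addSubgroupOf N0)) := by
  let f : N0 →+ (↥N ⧸ D.addSubgroupOf N) :=
    (QuotientAddGroup.mk' (D.addSubgroupOf N)).comp (AddSubgroup.inclusion h1)
  have hs : Function.Surjective f := by
    intro y
    obtain ⟨⟨x, hx⟩, rfl⟩ := QuotientAddGroup.mk'_surjective _ y
    obtain ⟨a, ha, b, hb, hab⟩ := AddSubgroup.mem_sup.1 (h2 hx)
    refine ⟨⟨a, ha⟩, ?_⟩
    apply (QuotientAddGroup.eq).2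
    rw [AddSubgroup.mem_addSubgroupOf]
    have : ((-(AddSubgroup.inclusion h1 ⟨a, ha⟩) + ⟨x, hx⟩ : N) : C) = b := by
      simp [← hab]
    rw [this]; exact hb
  have hk : f.ker = D0.addSubgroupOf N0 := by
    ext ⟨x, hx⟩
    rw [AddMonoidHom.mem_ker, AddSubgroup.mem_addSubgroupOf]
    change (QuotientAddGroup.mk' (D.addSubgroupOf N)) (AddSubgroup.inclusion h1 ⟨x, hx⟩) = 0 ↔ _
    rw [QuotientAddGroup.mk'_apply, QuotientAddGroup.eq_zero_iff, AddSubgroup.mem_addSubgroupOf]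
    exact h3 x hx
  exact ⟨((QuotientAddGroup.quotientAddEquivOfEq hk.symm).trans
    (QuotientAddGroup.quotientKerEquivOfSurjective f hs)).symm⟩

theorem Zset_closed {V : Type*} [Preorder V] {z q p b : Set V} {x y : V}
    (hx : x ∈ Zset z q p b) (hy : y ∈ p \ z) (h : x ≤ y ∨ y ≤ x) : y ∈ Zset z q p b := by
  obtain ⟨hx1, w, hw, hr⟩ := hx
  exact ⟨hy, w, hw, Relation.ReflTransGen.head ⟨hy, hx1, h.symm⟩ hr⟩

theorem Bset_closed {V : Type*} [Preorder V] {z q p b : Set V} {x y : V}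
    (hx : x ∈ Bset z q p b) (hy : y ∈ b \ q) (h : x ≤ y ∨ y ≤ x) : y ∈ Bset z q p b := by
  obtain ⟨hx1, w, hw, hr⟩ := hx
  exact ⟨hy, w, hw, Relation.ReflTransGen.head ⟨hy, hx1, h.symm⟩ hr⟩

theorem sterm_canon {V : Type*} [PartialOrder V] {C : Type*} [AddCommGroup C] (d : C →+ C)
    (F : LowerSet V → AddSubgroup C) (hm : Monotone F)
    (hd : ∀ a, ∀ x ∈ F a, d x ∈ F a)
    (hinf : ∀ a b, F (a ⊓ b) = F a ⊓ F b) (hsup : ∀ a b, F (a ⊔ b) = F a ⊔ F b)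
    (p z b q : LowerSet V) (hzp : z ≤ p) (hpb : p ≤ b) (hqp : q ≤ p) (Zs Bs : Set V)
    (hZ : Zset (z : Set V) q p b = Zs) (hB : Bset (z : Set V) q p b = Bs)
    (hpZ : (p : Set V) \ q ⊆ Zs) (hpB : (p : Set V) \ q ⊆ Bs) :
    ∃ z0 r0 : LowerSet V, (z0 : Set V) = ↑(lowerClosure Zs) \ Zs ∧
      (r0 : Set V) = (↑(lowerClosure Zs) ∪ ↑(lowerClosure Bs)) \ Bs ∧
      Nonempty (Sterm d (F p) (F z) (F b) (F q) ≃+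
        Sterm d (F (lowerClosure Zs)) (F z0) (F (lowerClosure Bs)) (F r0)) := by
  have hZp : ∀ x ∈ Zs, x ∈ p ∧ x ∉ z := by
    intro x hx; rw [← hZ] at hx; exact hx.1
  have hBb : ∀ x ∈ Bs, x ∈ b ∧ x ∉ q := by
    intro x hx; rw [← hB] at hx; exact hx.1
  have cZ : ∀ x ∈ Zs, ∀ y ∈ p, y ∉ z → (x ≤ y ∨ y ≤ x) → y ∈ Zs := by
    intro x hx y hy hy' h; rw [← hZ] at hx ⊢; exact Zset_closed hx ⟨hy, hy'⟩ h
  have cB : ∀ x ∈ Bs, ∀ y ∈ b, y ∉ q → (x ≤ y ∨ y ≤ x) → y ∈ Bs := by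
    intro x hx y hy hy' h; rw [← hB] at hx ⊢; exact Bset_closed hx ⟨hy, hy'⟩ h
  clear hZ hB
  let p2 : LowerSet V := ⟨(p : Set V) \ Zs, by
    intro x y hyx hx
    refine ⟨p.lower hyx hx.1, fun hy => hx.2 ?_⟩
    exact cZ y hy x hx.1 (fun h => (hZp y hy).2 (z.lower hyx h)) (Or.inl hyx)⟩
  let b2 : LowerSet V := ⟨(b : Set V) \ Bs, by
    intro x y hyx hx
    refine ⟨b.lower hyx hx.1, fun hy => hx.2 ?_⟩
    exact cB y hy x hx.1 (fun h => (hBb y hy).2 (q.lower hyx h)) (Or.inl hyx)⟩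
  have mp2 : ∀ x, x ∈ p2 ↔ x ∈ p ∧ x ∉ Zs := fun x => Iff.rfl
  have mb2 : ∀ x, x ∈ b2 ↔ x ∈ b ∧ x ∉ Bs := fun x => Iff.rfl
  set LZ := lowerClosure Zs with hLZ
  set LB := lowerClosure Bs with hLB
  have hLZp : LZ ≤ p := lowerClosure_le.2 fun x hx => (hZp x hx).1
  have hLBb : LB ≤ b := lowerClosure_le.2 fun x hx => (hBb x hx).1
  have hZL : ∀ x ∈ Zs, x ∈ LZ := fun x hx => subset_lowerClosure hx
  have hBL : ∀ x ∈ Bs, x ∈ LB := fun x hx => subset_lowerClosure hx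
  have ep : p = LZ ⊔ p2 := by
    ext x
    simp only [SetLike.mem_coe, LowerSet.mem_sup_iff, mp2]
    constructor
    · intro h
      by_cases hx : x ∈ Zs
      · exact Or.inl (hZL x hx)
      · exact Or.inr ⟨h, hx⟩
    · rintro (h | h)
      · exact hLZp h
      · exact h.1
  have eb : b = LB ⊔ b2 := by
    ext x
    simp only [SetLike.mem_coe, LowerSet.mem_sup_iff, mb2]
    constructor
    · intro h
      by_cases hx : x ∈ Bs
      · exact Or.inl (hBL x hx)
      · exact Or.inr ⟨h, hx⟩
    · rintro (h | h)
      · exact hLBb h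
      · exact h.1
  have hp2q : p2 ≤ q := by
    intro x hx
    by_contra h
    exact hx.2 (hpZ ⟨hx.1, h⟩)
  have hzp2 : z ≤ p2 := fun x hx => ⟨hzp hx, fun h => (hZp x h).2 hx⟩
  have hqb2 : q ≤ b2 := fun x hx => ⟨hpb (hqp hx), fun h => (hBb x h).2 hx⟩
  have hz0z : LZ ⊓ p2 ≤ z := by
    intro x hx
    have hx1 := hx.1
    have hx2 := hx.2
    by_contra h
    obtain ⟨y, hy, hxy⟩ := hx1
    exact hx2.2 (cZ y hy x hx2.1 h (Or.inr hxy))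
  have hr0q : (LZ ⊔ LB) ⊓ b2 ≤ q := by
    intro x hx
    have hx1 := hx.1
    have hx2 := hx.2
    by_contra h
    rcases hx1 with hx1 | hx1
    · exact hx2.2 (hpB ⟨hLZp hx1, h⟩)
    · obtain ⟨y, hy, hxy⟩ := hx1
      exact hx2.2 (cB y hy x hx2.1 h (Or.inr hxy))
  refine ⟨LZ ⊓ p2, (LZ ⊔ LB) ⊓ b2, ?_, ?_, ?_⟩
  · ext x
    simp only [LowerSet.coe_inf, Set.mem_inter_iff, SetLike.mem_coe, mp2, Set.mem_sdiff]
    constructor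
    · rintro ⟨h1, h2, h3⟩; exact ⟨h1, h3⟩
    · rintro ⟨h1, h3⟩; exact ⟨h1, hLZp h1, h3⟩
  · ext x
    simp only [LowerSet.coe_inf, LowerSet.coe_sup, Set.mem_inter_iff, SetLike.mem_coe, mb2,
      Set.mem_sdiff, Set.mem_union]
    constructor
    · rintro ⟨h1, h2, h3⟩; exact ⟨h1, h3⟩
    · rintro ⟨h1, h3⟩
      refine ⟨h1, ?_, h3⟩
      rcases h1 with h | h
      · exact hpb (hLZp h)
      · exact hLBb h
  · apply quot_iso
    · intro x hx
      exact ⟨hm hLZp hx.1, hm hz0z hx.2⟩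
    · intro x hx
      have hx1 : x ∈ F p := hx.1
      have hx2 : d x ∈ F z := hx.2
      rw [ep, hsup] at hx1
      obtain ⟨v, hv, u, hu, rfl⟩ := AddSubgroup.mem_sup.1 hx1
      refine AddSubgroup.add_mem_sup ⟨hv, ?_⟩ (AddSubgroup.mem_sup_right (hm hp2q hu))
      change d v ∈ F (LZ ⊓ p2)
      rw [hinf]
      refine ⟨hd _ _ hv, ?_⟩
      have : d v = d (v + u) - d u := by simp
      rw [this]
      exact (F p2).sub_mem (hm hzp2 hx2) (hd _ _ hu)
    · intro x hx
      have hx1 : x ∈ F LZ := hx.1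
      constructor
      · intro h
        obtain ⟨_, ⟨β, hβ, rfl⟩, u, hu, hxe⟩ := AddSubgroup.mem_sup.1 h
        have hβ' : β ∈ F b := hβ
        rw [eb, hsup] at hβ'
        obtain ⟨β3, h3, β2, h2, rfl⟩ := AddSubgroup.mem_sup.1 hβ'
        have e : x = d β3 + (d β2 + u) := by rw [← hxe, map_add]; abel
        rw [e]
        refine AddSubgroup.add_mem_sup ⟨β3, h3, rfl⟩ ?_
        rw [hinf]
        refine ⟨?_, add_mem (hd _ _ h2) (hm hqb2 hu)⟩
        have e2 : d β2 + u = x - d β3 := by rw [e]; abel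
        rw [e2]
        exact (F (LZ ⊔ LB)).sub_mem (hm le_sup_left hx1) (hm le_sup_right (hd _ _ h3))
      · intro h
        obtain ⟨_, ⟨β, hβ, rfl⟩, u, hu, hxe⟩ := AddSubgroup.mem_sup.1 h
        rw [← hxe]
        exact AddSubgroup.add_mem_sup ⟨β, hm hLBb hβ, rfl⟩ (hm hr0q hu)

theorem sterm_iso {V : Type*} [PartialOrder V] {C : Type*} [AddCommGroup C] (d : C →+ C)
    (F : LowerSet V → AddSubgroup C) (hm : Monotone F)
    (hd : ∀ a, ∀ x ∈ F a, d x ∈ F a)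
    (hinf : ∀ a b, F (a ⊓ b) = F a ⊓ F b) (hsup : ∀ a b, F (a ⊔ b) = F a ⊔ F b)
    (p z b q p' z' b' q' : LowerSet V) (hzp : z ≤ p) (hpb : p ≤ b) (hqp : q ≤ p)
    (hzp' : z' ≤ p') (hpb' : p' ≤ b') (hqp' : q' ≤ p') (Zs Bs : Set V)
    (hZ : Zset (z : Set V) q p b = Zs) (hB : Bset (z : Set V) q p b = Bs)
    (hZ' : Zset (z' : Set V) q' p' b' = Zs) (hB' : Bset (z' : Set V) q' p' b' = Bs)
    (hpZ : (p : Set V) \ q ⊆ Zs) (hpB : (p : Set V) \ q ⊆ Bs)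
    (hpZ' : (p' : Set V) \ q' ⊆ Zs) (hpB' : (p' : Set V) \ q' ⊆ Bs) :
    Nonempty (Sterm d (F p) (F z) (F b) (F q) ≃+ Sterm d (F p') (F z') (F b') (F q')) := by
  obtain ⟨z0, r0, h1, h2, ⟨e⟩⟩ := sterm_canon d F hm hd hinf hsup p z b q hzp hpb hqp Zs Bs hZ hB
    hpZ hpB
  obtain ⟨z1, r1, h1', h2', ⟨e'⟩⟩ := sterm_canon d F hm hd hinf hsup p' z' b' q' hzp' hpb' hqp'
    Zs Bs hZ' hB' hpZ' hpB'
  obtain rfl : z0 = z1 := SetLike.coe_injective (h1.trans h1'.symm)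
  obtain rfl : r0 = r1 := SetLike.coe_injective (h2.trans h2'.symm)
  exact ⟨e.trans e'.symm⟩


theorem comp_eq {V : Type*} [Preorder V] (A R : Set V) (P : V) (h1 : R ⊆ A)
    (h2 : ∀ r ∈ R, ∀ y ∈ A, (r ≤ y ∨ y ≤ r) → y ∈ R) (h3 : ∀ r ∈ R, ReachIn A r P)
    (h4 : A.Nonempty → P ∈ R) :
    {x | x ∈ A ∧ ∃ y ∈ ({P} : Set V), ReachIn A x y} = R := by
  ext x
  constructor
  · rintro ⟨hx, y, rfl, hr⟩
    have hP := h4 ⟨x, hx⟩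
    induction hr using Relation.ReflTransGen.head_induction_on with
    | refl => exact hP
    | head h _ ih => exact h2 _ (ih h.2.1) _ h.1 h.2.2.symm
  · intro hx
    exact ⟨h1 hx, P, rfl, h3 x hx⟩


theorem lexLe_iff {n : ℕ} (x y : Fin n → ℤ) : lexLe x y ↔ toLex x ≤ toLex y := by
  rw [le_iff_eq_or_lt]
  constructor
  · rintro (h | h)
    · exact Or.inl (by rw [h])
    · exact Or.inr h
  · rintro (h | h)
    · exact Or.inl (toLex.injective h)
    · exact Or.inr h

theorem lexLe_trans {n : ℕ} {x y z : Fin n → ℤ} (h : lexLe x y) (h' : lexLe y z) :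
    lexLe x z := by
  rw [lexLe_iff] at *; exact h.trans h'

theorem lexLe_antisymm {n : ℕ} {x y : Fin n → ℤ} (h : lexLe x y) (h' : lexLe y x) :
    x = y := by
  rw [lexLe_iff] at *; exact toLex.injective (le_antisymm h h')

theorem lexLe_total {n : ℕ} (x y : Fin n → ℤ) : lexLe x y ∨ lexLe y x := by
  simp only [lexLe_iff]; exact le_total _ _

theorem lexLe_refl {n : ℕ} (x : Fin n → ℤ) : lexLe x x := Or.inl rfl

theorem lexLe_of_le {n : ℕ} {x y : Fin n → ℤ} (h : x ≤ y) : lexLe x y := by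
  rw [lexLe_iff]; exact Pi.toLex_monotone h

theorem lexLe_add {n : ℕ} (x y z : Fin n → ℤ) : lexLe (x + z) (y + z) ↔ lexLe x y := by
  simp [lexLe]

theorem lexLe_sub {n : ℕ} (x y z : Fin n → ℤ) : lexLe (z - x) (z - y) ↔ lexLe y x := by
  unfold lexLe
  simp only [Pi.sub_apply, sub_right_inj, sub_lt_sub_iff_left, eq_comm]

theorem lexLe_coord {n : ℕ} {x y : Fin n → ℤ} (h : lexLe x y) (j : Fin n)
    (hj : ∀ i < j, x i = y i) : x j ≤ y j := by
  rcases h with rfl | ⟨i, h1, h2⟩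
  · exact le_rfl
  · rcases lt_trichotomy i j with hij | rfl | hij
    · have := hj i hij; omega
    · exact h2.le
    · exact (h1 j hij).le

theorem lexLe_step {n : ℕ} (y a a' : Fin n → ℤ)
    (h : ∀ j : Fin n, a j - a' j = if (j : ℕ) + 1 = n then 1 else 0) :
    lexLe y a ↔ lexLe y a' ∨ y = a := by
  have hle : a' ≤ a := by
    intro j; change (a' j : ℤ) ≤ a j; have := h j; split_ifs at this <;> omega
  constructor
  · rintro (rfl | ⟨i, h1, h2⟩)
    · exact Or.inr rfl
    · left
      have hlt : ∀ j < i, y j = a' j := by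
        intro j hj
        have e := h j
        have : (j : ℕ) < i := hj
        rw [if_neg (by omega)] at e
        have := h1 j hj
        omega
      by_cases hi : y i < a' i
      · exact Or.inr ⟨i, hlt, hi⟩
      · left
        have e := h i
        have hin : (i : ℕ) + 1 = n := by
          by_contra hc
          rw [if_neg hc] at e; omega
        rw [if_pos hin] at e
        funext j
        rcases lt_or_eq_of_le (show (j : ℕ) ≤ i by omega) with hj | hj
        · exact hlt j hj
        · have : j = i := Fin.ext hj
          subst this; omega
  · rintro (h' | rfl)
    · exact lexLe_trans h' (lexLe_of_le hle)
    · exact lexLe_refl _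


def tS (n k j : ℕ) (X : Fin n → ℤ) : ℤ :=
  ∑ i : Fin n, if j ≤ (i : ℕ) ∧ (i : ℕ) < k then X i else 0

theorem tS_add (n k j : ℕ) (X Y : Fin n → ℤ) : tS n k j (X + Y) = tS n k j X + tS n k j Y := by
  unfold tS
  rw [← Finset.sum_add_distrib]
  refine Finset.sum_congr rfl fun i _ => ?_
  split_ifs <;> simp

theorem tS_sub (n k j : ℕ) (X Y : Fin n → ℤ) : tS n k j (X - Y) = tS n k j X - tS n k j Y := by
  have := tS_add n k j (X - Y) Y
  rw [sub_add_cancel] at this; omega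

theorem tS_nonneg (n k j : ℕ) (X : Fin n → ℤ) (h : 0 ≤ X) : 0 ≤ tS n k j X :=
  Finset.sum_nonneg fun i _ => by
    split_ifs
    · exact h i
    · exact le_rfl

theorem tS_anti (n k i j : ℕ) (hij : i ≤ j) (X : Fin n → ℤ) (h : 0 ≤ X) :
    tS n k j X ≤ tS n k i X :=
  Finset.sum_le_sum fun l _ => by
    have := h l
    simp only [Pi.zero_apply] at this
    split_ifs <;> omega

theorem tS_ge (n k j : ℕ) (hj : k ≤ j) (X : Fin n → ℤ) : tS n k j X = 0 :=
  Finset.sum_eq_zero fun i _ => if_neg (by omega)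

theorem tS_rec (n k : ℕ) (i : Fin n) (hi : (i : ℕ) < k) (X : Fin n → ℤ) :
    tS n k i X = X i + tS n k (i + 1) X := by
  unfold tS
  rw [← Finset.add_sum_erase _ _ (Finset.mem_univ i),
    ← Finset.add_sum_erase (Finset.univ) (fun l : Fin n =>
      if (i : ℕ) + 1 ≤ (l : ℕ) ∧ (l : ℕ) < k then X l else 0) (Finset.mem_univ i)]
  simp only [le_refl, hi, and_self, if_true]
  rw [if_neg (by omega), zero_add]
  congr 1
  refine Finset.sum_congr rfl fun l hl => ?_
  have : l ≠ i := Finset.ne_of_mem_erase hl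
  have : (l : ℕ) ≠ i := fun h => this (Fin.ext h)
  split_ifs <;> first | rfl | omega

theorem tS_succ (n k j : ℕ) (hk : k < n) (hj : j ≤ k) (X : Fin n → ℤ) :
    tS n (k + 1) j X = tS n k j X + X ⟨k, hk⟩ := by
  unfold tS
  rw [← Finset.add_sum_erase _ _ (Finset.mem_univ (⟨k, hk⟩ : Fin n)),
    ← Finset.add_sum_erase (Finset.univ) (fun l : Fin n =>
      if j ≤ (l : ℕ) ∧ (l : ℕ) < k then X l else 0) (Finset.mem_univ (⟨k, hk⟩ : Fin n))]
  simp only [lt_irrefl, and_false, if_false, zero_add]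
  rw [if_pos (by omega), add_comm]
  congr 1
  refine Finset.sum_congr rfl fun l hl => ?_
  have : l ≠ ⟨k, hk⟩ := Finset.ne_of_mem_erase hl
  have : (l : ℕ) ≠ k := fun h => this (Fin.ext h)
  split_ifs <;> first | rfl | omega

theorem phi_lt (n k : ℕ) (X : Fin n → ℤ) (j : Fin n) (h : (j : ℕ) + k < n) :
    phiAut n k X j = X ⟨(j : ℕ) + k, h⟩ := dif_pos h

theorem phi_ge (n k : ℕ) (X : Fin n → ℤ) (j : Fin n) (h : ¬ (j : ℕ) + k < n) :
    phiAut n k X j = tS n k ((j : ℕ) + k - n) X := dif_neg h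

theorem phi_add (n k : ℕ) (X Y : Fin n → ℤ) :
    phiAut n k (X + Y) = phiAut n k X + phiAut n k Y := by
  funext j
  by_cases h : (j : ℕ) + k < n
  · simp [phi_lt _ _ _ _ h]
  · simp [phi_ge _ _ _ _ h, tS_add]

theorem phi_sub (n k : ℕ) (X Y : Fin n → ℤ) :
    phiAut n k (X - Y) = phiAut n k X - phiAut n k Y := by
  have := phi_add n k (X - Y) Y
  rw [sub_add_cancel] at this; rw [this, add_sub_cancel_right]

theorem phi_zero (n k : ℕ) : phiAut n k 0 = 0 := by
  have := phi_add n k 0 0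
  simpa using this

theorem phi_inj0 (n k : ℕ) (hk : k ≤ n) (X : Fin n → ℤ) (h : phiAut n k X = 0) : X = 0 := by
  have ht : ∀ i, tS n k i X = 0 := by
    intro i
    by_cases hi : i < k
    · have := congrFun h ⟨n - k + i, by omega⟩
      rw [phi_ge _ _ _ _ (by simp only; omega)] at this
      have e : n - k + i + k - n = i := by omega
      simpa [e] using this
    · exact tS_ge _ _ _ (by omega) _
  funext i
  by_cases hi : (i : ℕ) < k
  · have := tS_rec n k i hi X
    rw [ht, ht] at this; simp; omega
  · have := congrFun h ⟨i - k, by omega⟩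
    rw [phi_lt _ _ _ _ (by simp only; omega)] at this
    have e : (i : ℕ) - k + k = i := by omega
    simpa [e] using this

theorem phi_inj (n k : ℕ) (hk : k ≤ n) {X Y : Fin n → ℤ} (h : phiAut n k X = phiAut n k Y) :
    X = Y := by
  have := phi_inj0 n k hk (X - Y) (by rw [phi_sub, h, sub_self])
  exact sub_eq_zero.1 this

theorem stdE_zero (n : ℕ) : stdE n 0 = 0 := by
  funext i
  simp only [stdE]
  rw [if_neg (by omega), if_neg (by omega)]; rfl

theorem stdE_succ (n k : ℕ) (i : Fin n) :
    stdE n ((k : ℤ) + 1) i = if (i : ℕ) = k then 1 else 0 := by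
  simp only [stdE]
  by_cases h : (i : ℕ) = k
  · rw [if_pos (by omega), if_pos h]
  · rw [if_neg (by omega), if_neg (by omega), if_neg h]

theorem stdE_nonneg (n k : ℕ) : 0 ≤ stdE n (k : ℤ) := by
  intro i
  change (0 : ℤ) ≤ stdE n (k : ℤ) i
  rcases k with _ | k
  · simp [stdE_zero]
  · push_cast
    rw [stdE_succ]
    by_cases h : (i : ℕ) = k <;> simp [h]

theorem tS_stdE (n k j m : ℕ) (hm : m < n) :
    tS n k j (stdE n ((m : ℤ) + 1)) = if j ≤ m ∧ m < k then 1 else 0 := by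
  unfold tS
  rw [Finset.sum_eq_single (⟨m, hm⟩ : Fin n)]
  · simp [stdE_succ]
  · intro l _ hl
    have : (l : ℕ) ≠ m := fun h => hl (Fin.ext h)
    simp [stdE_succ, this]
  · simp

theorem phi_e (n k : ℕ) (hk : k ≤ n) (j : Fin n) :
    phiAut n k (stdE n (k : ℤ)) j = if (j : ℕ) + k < n then 0 else 1 := by
  have hj := j.2
  rcases k with _ | k
  · simp [stdE_zero, phi_zero]
  · push_cast
    by_cases h : (j : ℕ) + (k + 1) < n
    · rw [phi_lt _ _ _ _ h, stdE_succ, if_pos h, if_neg (by simp only; omega)]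
    · rw [phi_ge _ _ _ _ h, tS_stdE _ _ _ _ (by omega), if_neg h, if_pos (by omega)]

theorem phi_e_step (n k : ℕ) (hk : k ≤ n) (j : Fin n) :
    phiAut n k (stdE n (k : ℤ)) j - phiAut n k (stdE n ((k : ℤ) - 1)) j =
      if (j : ℕ) + 1 = n then 1 else 0 := by
  have hj := j.2
  rw [phi_e n k hk]
  rcases k with _ | _ | k
  · rw [phi_lt _ _ _ _ (by omega)]
    simp [stdE, hj]
    split_ifs <;> omega
  · simp [stdE_zero, phi_zero]
    split_ifs <;> omega
  · have e : (((k + 1 + 1 : ℕ) : ℤ) - 1) = (k : ℤ) + 1 := by push_cast; ring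
    rw [e]
    by_cases h : (j : ℕ) + (k + 1 + 1) < n
    · rw [phi_lt _ _ _ _ h, stdE_succ, if_pos h, if_neg (by simp only; omega),
        if_neg (by omega)]; rfl
    · rw [phi_ge _ _ _ _ h, tS_stdE _ _ _ _ (by omega), if_neg h]
      split_ifs <;> omega


def Wp (n k : ℕ) (X : Fin n → ℤ) : Prop :=
  (∀ i : Fin n, k ≤ (i : ℕ) → X i = 0) ∧ ∀ j, tS n k j X = 0 ∨ tS n k j X = 1

theorem Wp_succ (n k : ℕ) (hk : k < n) (X : Fin n → ℤ) :
    Wp n (k + 1) X ↔ Wp n k X ∨ Wp n k (stdE n ((k : ℤ) + 1) - X) := by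
  have hE : ∀ j, tS n k j (stdE n ((k : ℤ) + 1)) = 0 := by
    intro j; rw [tS_stdE _ _ _ _ hk, if_neg (by omega)]
  constructor
  · rintro ⟨h1, h2⟩
    have hx : X ⟨k, hk⟩ = 0 ∨ X ⟨k, hk⟩ = 1 := by
      have := h2 k
      rwa [tS_succ n k k hk le_rfl, tS_ge n k k le_rfl, zero_add] at this
    rcases hx with hx | hx
    · left
      refine ⟨fun i hi => ?_, fun j => ?_⟩
      · by_cases hik : (i : ℕ) = k
        · have : i = ⟨k, hk⟩ := Fin.ext hik
          rw [this, hx]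
        · exact h1 i (by omega)
      · by_cases hj : j ≤ k
        · have := h2 j
          rwa [tS_succ n k j hk hj, hx, add_zero] at this
        · left; exact tS_ge _ _ _ (by omega) _
    · right
      refine ⟨fun i hi => ?_, fun j => ?_⟩
      · rw [Pi.sub_apply, stdE_succ]
        by_cases hik : (i : ℕ) = k
        · have : i = ⟨k, hk⟩ := Fin.ext hik
          rw [this, hx]; simp
        · rw [if_neg hik, h1 i (by omega)]; simp
      · by_cases hj : j ≤ k
        · have := h2 j
          rw [tS_succ n k j hk hj, hx] at this
          rw [tS_sub, hE]
          omega
        · left; exact tS_ge _ _ _ (by omega) _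
  · rintro (⟨h1, h2⟩ | ⟨h1, h2⟩)
    · refine ⟨fun i hi => h1 i (by omega), fun j => ?_⟩
      by_cases hj : j ≤ k
      · rw [tS_succ n k j hk hj, h1 ⟨k, hk⟩ le_rfl, add_zero]; exact h2 j
      · left; exact tS_ge _ _ _ (by omega) _
    · refine ⟨fun i hi => ?_, fun j => ?_⟩
      · have := h1 i (by omega)
        rw [Pi.sub_apply, stdE_succ, if_neg (by omega)] at this
        omega
      · by_cases hj : j ≤ k
        · have a := h1 ⟨k, hk⟩ le_rfl
          rw [Pi.sub_apply, stdE_succ, if_pos rfl] at a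
          have b := h2 j
          rw [tS_sub, hE] at b
          rw [tS_succ n k j hk hj]
          omega
        · left; exact tS_ge _ _ _ (by omega) _

theorem Vm_iff (n k : ℕ) (hk : k ≤ n) (X : Fin n → ℤ) : X ∈ Vm n (k + 1) ↔ Wp n k X := by
  induction k generalizing X with
  | zero =>
    change X ∈ ({0} : Set _) ↔ _
    constructor
    · rintro rfl
      exact ⟨fun i _ => rfl, fun j => Or.inl (tS_ge _ _ _ (by omega) _)⟩
    · rintro ⟨h, _⟩
      exact funext fun i => h i (Nat.zero_le _)
  | succ k ih =>
    rw [Wp_succ n k (by omega), ← ih (by omega), ← ih (by omega)]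
    change X ∈ Vm n (k + 1) ∪ (fun v => stdE n ((k : ℤ) + 1) - v) '' Vm n (k + 1) ↔ _
    constructor
    · rintro (h | ⟨v, hv, rfl⟩)
      · exact Or.inl h
      · right; simpa using hv
    · rintro (h | h)
      · exact Or.inl h
      · exact Or.inr ⟨_, h, by simp⟩

theorem zero_mem_Vm (n k : ℕ) : (0 : Fin n → ℤ) ∈ Vm n (k + 1) := by
  induction k with
  | zero => rfl
  | succ k ih => exact Or.inl ih

theorem reach_mono {V : Type*} [Preorder V] {A B : Set V} (h : A ⊆ B) {x y : V}
    (hr : ReachIn A x y) : ReachIn B x y :=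
  Relation.ReflTransGen.mono (fun _ _ hab => ⟨h hab.1, h hab.2.1, hab.2.2⟩) _ _ hr

theorem reach_sub {n : ℕ} {A B : Set (Fin n → ℤ)} (P : Fin n → ℤ)
    (h : ∀ a ∈ A, P - a ∈ B) {x y : Fin n → ℤ}
    (hr : ReachIn A x y) : ReachIn B (P - x) (P - y) :=
  Relation.ReflTransGen.lift (fun a => P - a)
    (fun _ _ hab => ⟨h _ hab.1, h _ hab.2.1, hab.2.2.symm.imp
      (fun h => sub_le_sub_left h P) (fun h => sub_le_sub_left h P)⟩) _ _ hr

theorem reach_add {n : ℕ} {A B : Set (Fin n → ℤ)} (P : Fin n → ℤ)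
    (h : ∀ a ∈ A, P + a ∈ B) {x y : Fin n → ℤ}
    (hr : ReachIn A x y) : ReachIn B (P + x) (P + y) :=
  Relation.ReflTransGen.lift (fun a => P + a)
    (fun _ _ hab => ⟨h _ hab.1, h _ hab.2.1, hab.2.2.imp
      (fun h => add_le_add_right h P) (fun h => add_le_add_right h P)⟩) _ _ hr

theorem Vm_reach (n k : ℕ) : ∀ v ∈ Vm n (k + 1), ReachIn (Vm n (k + 1)) v 0 := by
  induction k with
  | zero =>
    rintro v rfl
    exact Relation.ReflTransGen.refl
  | succ k ih =>
    have hsub : Vm n (k + 1) ⊆ Vm n (k + 1 + 1) := fun x hx => Or.inl hx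
    have hE : ∀ a ∈ Vm n (k + 1), stdE n ((k : ℤ) + 1) - a ∈ Vm n (k + 1 + 1) :=
      fun a ha => Or.inr ⟨a, ha, rfl⟩
    rintro v (hv | ⟨w, hw, rfl⟩)
    · exact reach_mono hsub (ih v hv)
    · have h1 := reach_sub _ hE (ih w hw)
      refine Relation.ReflTransGen.tail h1 ⟨hE _ (zero_mem_Vm n k), zero_mem_Vm n (k + 1), ?_⟩
      right
      rw [sub_zero]
      have := stdE_nonneg n (k + 1)
      push_cast at this; exact this

def Qs (n k : ℕ) : Set (Fin n → ℤ) :=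
  {X | lexLe 0 (phiAut n k X) ∧ lexLe (phiAut n k X) (phiAut n k (stdE n (k : ℤ)))}

theorem Wp_phi (n k : ℕ) (hk : k ≤ n) (X : Fin n → ℤ) :
    Wp n k X ↔ ∀ j : Fin n, phiAut n k X j = 0 ∨ (¬ (j : ℕ) + k < n ∧ phiAut n k X j = 1) := by
  constructor
  · rintro ⟨h1, h2⟩ j
    by_cases h : (j : ℕ) + k < n
    · left; rw [phi_lt _ _ _ _ h]; exact h1 _ (by simp)
    · rw [phi_ge _ _ _ _ h]
      exact (h2 _).imp id fun a => ⟨h, a⟩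
  · intro h
    refine ⟨fun i hi => ?_, fun i => ?_⟩
    · have := h ⟨i - k, by omega⟩
      have e : (i : ℕ) - k + k = i := by omega
      rw [phi_lt _ _ _ _ (by simp only; omega)] at this
      simpa [e] using this
    · by_cases hi : i < k
      · have := h ⟨n - k + i, by omega⟩
        rw [phi_ge _ _ _ _ (by simp only; omega)] at this
        have e : n - k + i + k - n = i := by omega
        simp only [e] at this
        exact this.imp id fun a => a.2
      · left; exact tS_ge _ _ _ (by omega) _

theorem Wp_Qs (n k : ℕ) (hk : k ≤ n) (X : Fin n → ℤ) (h : Wp n k X) : X ∈ Qs n k := by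
  rw [Wp_phi n k hk] at h
  constructor
  · apply lexLe_of_le
    intro j
    simp only [Pi.zero_apply]
    have := h j
    omega
  · apply lexLe_of_le
    intro j
    change (phiAut n k X j : ℤ) ≤ phiAut n k (stdE n (k : ℤ)) j
    rw [phi_e n k hk]
    have := h j
    split_ifs <;> omega

theorem Wp_closed (n k : ℕ) (hk : k ≤ n) (X Y : Fin n → ℤ) (h : Wp n k X) (hY : Y ∈ Qs n k)
    (hc : X ≤ Y ∨ Y ≤ X) : Wp n k Y := by
  rw [Wp_phi n k hk] at h ⊢
  obtain ⟨hY0, hY1⟩ := hY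
  have key : ∀ m : ℕ, ∀ j : Fin n, (j : ℕ) = m →
      phiAut n k Y j = 0 ∨ (¬ (j : ℕ) + k < n ∧ phiAut n k Y j = 1) := by
    intro m
    induction m using Nat.strong_induction_on with
    | _ m ih =>
    intro j hj
    have ih' : ∀ i < j, phiAut n k Y i = 0 ∨ (¬ (i : ℕ) + k < n ∧ phiAut n k Y i = 1) := by
      intro i hi
      exact ih i (by have : (i : ℕ) < j := hi; omega) i rfl
    have up : (∀ i < j, phiAut n k Y i = if (i : ℕ) + k < n then 0 else 1) →
        phiAut n k Y j ≤ if (j : ℕ) + k < n then 0 else 1 := by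
      intro hh
      have := lexLe_coord hY1 j (fun i hi => by rw [hh i hi, phi_e n k hk])
      rwa [phi_e n k hk] at this
    have lo : (∀ i < j, phiAut n k Y i = 0) → 0 ≤ phiAut n k Y j := by
      intro hh
      exact lexLe_coord hY0 j (fun i hi => by rw [hh i hi]; rfl)
    by_cases hjk : (j : ℕ) + k < n
    · have hz : ∀ i < j, phiAut n k Y i = 0 := by
        intro i hi
        have : (i : ℕ) < j := hi
        have := ih' i hi
        omega
      have h1 := lo hz
      have h2 := up (fun i hi => by
        have : (i : ℕ) < j := hi
        rw [hz i hi, if_pos (by omega)])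
      rw [if_pos hjk] at h2
      left; omega
    · have hxj := h j
      rcases hc with hc | hc
      · have hw : 0 ≤ Y - X := sub_nonneg.2 hc
        have w0 := tS_nonneg n k (j + k - n) _ hw
        rw [tS_sub, ← phi_ge n k Y j hjk, ← phi_ge n k X j hjk] at w0
        by_cases he : phiAut n k Y j = phiAut n k X j
        · rw [he]; exact hxj
        · have := up (fun i hi => by
            have hi' : (i : ℕ) < j := hi
            have hyi := ih' i hi
            by_cases hik : (i : ℕ) + k < n
            · rw [if_pos hik]; omega
            · rw [if_neg hik]
              have a := tS_anti n k (i + k - n) (j + k - n) (by omega) _ hw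
              rw [tS_sub, tS_sub, ← phi_ge n k Y j hjk, ← phi_ge n k X j hjk,
                ← phi_ge n k Y i hik, ← phi_ge n k X i hik] at a
              have := h i
              omega)
          rw [if_neg hjk] at this
          omega
      · have hw : 0 ≤ X - Y := sub_nonneg.2 hc
        have w0 := tS_nonneg n k (j + k - n) _ hw
        rw [tS_sub, ← phi_ge n k Y j hjk, ← phi_ge n k X j hjk] at w0
        by_cases he : phiAut n k Y j = phiAut n k X j
        · rw [he]; exact hxj
        · have := lo (fun i hi => by
            have hi' : (i : ℕ) < j := hi
            have hyi := ih' i hi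
            by_cases hik : (i : ℕ) + k < n
            · omega
            · have a := tS_anti n k (i + k - n) (j + k - n) (by omega) _ hw
              rw [tS_sub, tS_sub, ← phi_ge n k Y j hjk, ← phi_ge n k X j hjk,
                ← phi_ge n k Y i hik, ← phi_ge n k X i hik] at a
              have := h i
              omega)
          omega
  exact fun j => key j j rfl

/-- Closedness of `V_{k-1}` in the punctured interval. -/
theorem Vm_closed' (n k : ℕ) (hk : k ≤ n) (X Y : Fin n → ℤ) (h : X ∈ Vm n k) (hY : Y ∈ Qs n k)
    (hne : Y ≠ stdE n (k : ℤ)) (hc : X ≤ Y ∨ Y ≤ X) : Y ∈ Vm n k := by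
  rcases k with _ | k
  · exact absurd h (Set.notMem_empty _)
  · have hX : Wp n k X := (Vm_iff n k (by omega) X).1 h
    have hX' : Wp n (k + 1) X := (Wp_succ n k (by omega) X).2 (Or.inl hX)
    have hY' := Wp_closed n (k + 1) hk X Y hX' hY hc
    rw [Vm_iff n k (by omega)]
    rcases (Wp_succ n k (by omega) Y).1 hY' with h' | h'
    · exact h'
    · exfalso
      apply hne
      have yk := h'.1 ⟨k, hk⟩ le_rfl
      rw [Pi.sub_apply, stdE_succ, if_pos rfl] at yk
      have xk := hX.1 ⟨k, hk⟩ le_rfl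
      have hxy : X ≤ Y := by
        rcases hc with hc | hc
        · exact hc
        · have : (Y ⟨k, hk⟩ : ℤ) ≤ X ⟨k, hk⟩ := hc ⟨k, hk⟩
          omega
      have hw : 0 ≤ Y - X := sub_nonneg.2 hxy
      apply phi_inj n (k + 1) hk
      funext j
      have hj := j.2
      rw [phi_e n (k + 1) hk]
      have hYp := (Wp_phi n (k + 1) hk Y).1 hY' j
      have hXp := (Wp_phi n (k + 1) hk X).1 hX' j
      by_cases hjk : (j : ℕ) + (k + 1) < n
      · rw [if_pos hjk]; omega
      · rw [if_neg hjk]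
        have a := tS_anti n (k + 1) (j + (k + 1) - n) k (by omega) _ hw
        rw [tS_sub, tS_sub, ← phi_ge n (k + 1) Y j hjk, ← phi_ge n (k + 1) X j hjk,
          tS_succ n k k (by omega) le_rfl, tS_succ n k k (by omega) le_rfl,
          tS_ge n k k le_rfl, tS_ge n k k le_rfl] at a
        omega

theorem Vm_sub' (n k : ℕ) (hk : k ≤ n) (X : Fin n → ℤ) (h : X ∈ Vm n k) :
    X ∈ Qs n k ∧ X ≠ stdE n (k : ℤ) := by
  rcases k with _ | k
  · exact absurd h (Set.notMem_empty _)
  · have hX : Wp n k X := (Vm_iff n k (by omega) X).1 h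
    refine ⟨Wp_Qs n (k + 1) hk X ((Wp_succ n k (by omega) X).2 (Or.inl hX)), ?_⟩
    rintro rfl
    have := hX.1 ⟨k, hk⟩ le_rfl
    push_cast at this
    rw [stdE_succ] at this
    simp at this

theorem Qs_zero (n : ℕ) (X : Fin n → ℤ) (h : X ∈ Qs n 0) : X = 0 := by
  obtain ⟨h1, h2⟩ := h
  simp only [Nat.cast_zero, stdE_zero, phi_zero] at h2
  exact phi_inj0 n 0 (Nat.zero_le _) X (lexLe_antisymm h2 h1)


section
variable (n k : ℕ) (hk : k ≤ n) (P : Fin n → ℤ)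

theorem mem_T (X Q : Fin n → ℤ) : X ∈ Tset n k Q ↔ lexLe (phiAut n k X) (phiAut n k Q) := Iff.rfl

theorem pq_eq : pSec n k P \ qSec n k P = {P} := by
  ext X
  simp only [pSec, qSec, Set.mem_sdiff, Set.mem_singleton_iff]
  constructor
  · rintro ⟨h1, h2⟩
    by_contra h
    exact h2 ⟨h1, h⟩
  · rintro rfl
    exact ⟨lexLe_refl _, fun h => h.2 rfl⟩

theorem lex_not_iff (hk : k ≤ n) (X Q : Fin n → ℤ) :
    X ∉ Tset n k Q \ {Q} ↔ lexLe (phiAut n k Q) (phiAut n k X) := by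
  simp only [Set.mem_sdiff, Set.mem_singleton_iff, not_and, not_not, mem_T]
  constructor
  · intro h
    rcases lexLe_total (phiAut n k X) (phiAut n k Q) with h' | h'
    · rw [h h']; exact lexLe_refl _
    · exact h'
  · intro h h'
    exact phi_inj n k hk (lexLe_antisymm h' h)

theorem mem_bs (hk : k ≤ n) (X : Fin n → ℤ) :
    X ∈ bsSec n k P ↔ lexLe (phiAut n k X) (phiAut n k (P + stdE n (k : ℤ))) := by
  have step := lexLe_step (phiAut n k X) (phiAut n k (P + stdE n (k : ℤ)))
    (phiAut n k (P + stdE n ((k : ℤ) - 1))) (fun j => by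
      rw [phi_add, phi_add, Pi.add_apply, Pi.add_apply, ← phi_e_step n k hk j]; ring)
  rw [step]
  simp only [bsSec, bSec, Set.mem_union, mem_T, Set.mem_singleton_iff]
  refine or_congr_right ⟨fun h => by rw [h], fun h => phi_inj n k hk h⟩

theorem mem_b (hn : 1 ≤ n) (hk : k ≤ n) (X : Fin n → ℤ) :
    X ∈ bSec n k P ↔ X ∈ bsSec n k P ∧ X ≠ P + stdE n (k : ℤ) := by
  constructor
  · intro h
    refine ⟨Or.inl h, ?_⟩
    rintro rfl
    have h' : lexLe (phiAut n k (P + stdE n ((k : ℤ) - 1))) (phiAut n k (P + stdE n (k : ℤ))) :=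
      (mem_bs n k P hk _).1 (Or.inl (lexLe_refl _))
    have e := lexLe_antisymm h' h
    have := phi_e_step n k hk ⟨n - 1, by omega⟩
    rw [if_pos (by simp only; omega)] at this
    rw [phi_add, phi_add] at e
    have e' := congrFun (add_left_cancel e) ⟨n - 1, by omega⟩
    omega
  · rintro ⟨h | h, h'⟩
    · exact h
    · exact absurd h h'

theorem bsq (hk : k ≤ n) (X : Fin n → ℤ) : X ∈ bsSec n k P \ qSec n k P ↔ X - P ∈ Qs n k := by
  rw [Set.mem_sdiff, mem_bs n k P hk, qSec, lex_not_iff n k hk]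
  simp only [Qs, Set.mem_ofPred_eq, phi_sub]
  rw [and_comm, ← lexLe_add 0 _ (phiAut n k P), ← lexLe_add _ (phiAut n k (stdE n (k : ℤ)))
    (phiAut n k P), sub_add_cancel, zero_add, phi_add, add_comm (phiAut n k P)]

theorem bq (hn : 1 ≤ n) (hk : k ≤ n) (X : Fin n → ℤ) :
    X ∈ bSec n k P \ qSec n k P ↔ X - P ∈ Qs n k ∧ X - P ≠ stdE n (k : ℤ) := by
  rw [← bsq n k P hk, Set.mem_sdiff, Set.mem_sdiff, mem_b n k P hn hk, Ne, Ne, sub_eq_iff_eq_add,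
    add_comm P]
  tauto

theorem pzs (hk : k ≤ n) (X : Fin n → ℤ) : X ∈ pSec n k P \ zsSec n k P ↔ P - X ∈ Qs n k := by
  rw [Set.mem_sdiff, zsSec, zSec, lex_not_iff n k hk, pSec, mem_T]
  simp only [Qs, Set.mem_ofPred_eq, phi_sub]
  rw [← lexLe_sub (phiAut n k P) _ (phiAut n k P), sub_self,
    ← lexLe_sub _ (phiAut n k P - _) (phiAut n k P), sub_sub_cancel]

theorem pz (hk : k ≤ n) (X : Fin n → ℤ) :
    X ∈ pSec n k P \ zSec n k P ↔ P - X ∈ Qs n k ∧ P - X ≠ stdE n (k : ℤ) := by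
  rw [← pzs n k P hk, Set.mem_sdiff, Set.mem_sdiff, zsSec, Set.mem_sdiff, Set.mem_singleton_iff]
  have : P - X = stdE n (k : ℤ) ↔ X = P - stdE n (k : ℤ) := by
    constructor
    · intro h; rw [← h]; simp
    · intro h; rw [h]; simp
  rw [Ne, this]
  have : X = P - stdE n (k : ℤ) → X ∈ zSec n k P := by
    rintro rfl; exact lexLe_refl _
  tauto

theorem comp_sub (A A0 R0 : Set (Fin n → ℤ)) (hA : ∀ X, X ∈ A ↔ P - X ∈ A0) (h1 : R0 ⊆ A0)
    (h2 : ∀ r ∈ R0, ∀ y ∈ A0, (r ≤ y ∨ y ≤ r) → y ∈ R0) (h3 : ∀ r ∈ R0, ReachIn R0 r 0)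
    (h4 : A0.Nonempty → (0 : Fin n → ℤ) ∈ R0) :
    {x | x ∈ A ∧ ∃ y ∈ ({P} : Set (Fin n → ℤ)), ReachIn A x y} = (fun v => P - v) '' R0 := by
  apply comp_eq
  · rintro _ ⟨v, hv, rfl⟩
    rw [hA]; simpa using h1 hv
  · rintro _ ⟨v, hv, rfl⟩ y hy hc
    refine ⟨P - y, h2 v hv _ ((hA y).1 hy) ?_, by simp⟩
    rcases hc with hc | hc
    · exact Or.inr (sub_le_comm.1 hc)
    · exact Or.inl (le_sub_comm.1 hc)
  · rintro _ ⟨v, hv, rfl⟩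
    have := reach_sub (B := A) P (fun a ha => by rw [hA]; simpa using h1 ha) (h3 v hv)
    simpa using this
  · rintro ⟨x, hx⟩
    exact ⟨0, h4 ⟨_, (hA x).1 hx⟩, by simp⟩

theorem comp_add (A A0 R0 : Set (Fin n → ℤ)) (hA : ∀ X, X ∈ A ↔ X - P ∈ A0) (h1 : R0 ⊆ A0)
    (h2 : ∀ r ∈ R0, ∀ y ∈ A0, (r ≤ y ∨ y ≤ r) → y ∈ R0) (h3 : ∀ r ∈ R0, ReachIn R0 r 0)
    (h4 : A0.Nonempty → (0 : Fin n → ℤ) ∈ R0) :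
    {x | x ∈ A ∧ ∃ y ∈ ({P} : Set (Fin n → ℤ)), ReachIn A x y} = (fun v => P + v) '' R0 := by
  apply comp_eq
  · rintro _ ⟨v, hv, rfl⟩
    rw [hA]; simpa using h1 hv
  · rintro _ ⟨v, hv, rfl⟩ y hy hc
    refine ⟨y - P, h2 v hv _ ((hA y).1 hy) ?_, by simp⟩
    rcases hc with hc | hc
    · exact Or.inl (by rw [le_sub_iff_add_le, add_comm]; exact hc)
    · exact Or.inr (by rw [sub_le_iff_le_add, add_comm]; exact hc)
  · rintro _ ⟨v, hv, rfl⟩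
    have := reach_add (B := A) P (fun a ha => by rw [hA]; simpa using h1 ha) (h3 v hv)
    simpa using this
  · rintro ⟨x, hx⟩
    exact ⟨0, h4 ⟨_, (hA x).1 hx⟩, by simp⟩

theorem punct (hk : k ≤ n) :
    Vm n k ⊆ {X | X ∈ Qs n k ∧ X ≠ stdE n (k : ℤ)} ∧
    (∀ r ∈ Vm n k, ∀ y ∈ {X | X ∈ Qs n k ∧ X ≠ stdE n (k : ℤ)}, (r ≤ y ∨ y ≤ r) → y ∈ Vm n k) ∧
    (∀ r ∈ Vm n k, ReachIn (Vm n k) r 0) ∧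
    ({X | X ∈ Qs n k ∧ X ≠ stdE n (k : ℤ)}.Nonempty → (0 : Fin n → ℤ) ∈ Vm n k) := by
  refine ⟨fun X h => Vm_sub' n k hk X h, fun r hr y hy hc => Vm_closed' n k hk r y hr hy.1 hy.2 hc,
    ?_, ?_⟩
  · rcases k with _ | k
    · intro r hr; exact absurd hr (Set.notMem_empty _)
    · exact Vm_reach n k
  · rintro ⟨X, h1, h2⟩
    rcases k with _ | k
    · exact absurd ((Qs_zero n X h1).trans (stdE_zero n).symm) h2
    · exact zero_mem_Vm n k

theorem full (hk : k ≤ n) :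
    Vm n (k + 1) ⊆ Qs n k ∧
    (∀ r ∈ Vm n (k + 1), ∀ y ∈ Qs n k, (r ≤ y ∨ y ≤ r) → y ∈ Vm n (k + 1)) ∧
    (∀ r ∈ Vm n (k + 1), ReachIn (Vm n (k + 1)) r 0) ∧
    ((Qs n k).Nonempty → (0 : Fin n → ℤ) ∈ Vm n (k + 1)) := by
  refine ⟨fun X h => Wp_Qs n k hk X ((Vm_iff n k hk X).1 h), fun r hr y hy hc => ?_,
    Vm_reach n k, fun _ => zero_mem_Vm n k⟩
  rw [Vm_iff n k hk] at hr ⊢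
  exact Wp_closed n k hk r y hr hy hc

theorem main_Z (hk : k ≤ n) :
    Zset (zSec n k P) (qSec n k P) (pSec n k P) (bSec n k P) = (fun v => P - v) '' Vm n k := by
  obtain ⟨h1, h2, h3, h4⟩ := punct n k hk
  unfold Zset
  rw [pq_eq]
  exact comp_sub n P _ _ _ (pz n k P hk) h1 h2 h3 h4

theorem main_B (hn : 1 ≤ n) (hk : k ≤ n) :
    Bset (zSec n k P) (qSec n k P) (pSec n k P) (bSec n k P) = (fun v => P + v) '' Vm n k := by
  obtain ⟨h1, h2, h3, h4⟩ := punct n k hk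
  unfold Bset
  rw [pq_eq]
  exact comp_add n P _ _ _ (bq n k P hn hk) h1 h2 h3 h4

theorem main_Zs (hk : k ≤ n) :
    Zset (zsSec n k P) (qSec n k P) (pSec n k P) (bsSec n k P) =
      (fun v => P - v) '' Vm n (k + 1) := by
  obtain ⟨h1, h2, h3, h4⟩ := full n k hk
  unfold Zset
  rw [pq_eq]
  exact comp_sub n P _ _ _ (pzs n k P hk) h1 h2 h3 h4

theorem main_Bs (hk : k ≤ n) :
    Bset (zsSec n k P) (qSec n k P) (pSec n k P) (bsSec n k P) =
      (fun v => P + v) '' Vm n (k + 1) := by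
  obtain ⟨h1, h2, h3, h4⟩ := full n k hk
  unfold Bset
  rw [pq_eq]
  exact comp_add n P _ _ _ (bsq n k P hk) h1 h2 h3 h4

theorem phi_e_nonneg (hk : k ≤ n) : 0 ≤ phiAut n k (stdE n (k : ℤ)) := by
  intro j
  change (0 : ℤ) ≤ phiAut n k (stdE n (k : ℤ)) j
  rw [phi_e n k hk]
  split_ifs <;> omega

theorem z_sub (hk : k ≤ n) : zSec n k P ⊆ pSec n k P := by
  intro X h
  refine lexLe_trans h (lexLe_of_le ?_)
  rw [phi_sub]
  exact sub_le_self _ (phi_e_nonneg n k hk)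

theorem p_sub_bs (hk : k ≤ n) : pSec n k P ⊆ bsSec n k P := by
  intro X h
  rw [mem_bs n k P hk]
  refine lexLe_trans h (lexLe_of_le ?_)
  rw [phi_add]
  exact le_add_of_nonneg_right (phi_e_nonneg n k hk)

theorem p_sub_b (hn : 1 ≤ n) (hk : k + 1 ≤ n) : pSec n (k + 1) P ⊆ bSec n (k + 1) P := by
  intro X h
  rw [mem_b n (k + 1) P hn hk]
  refine ⟨p_sub_bs n (k + 1) P hk h, ?_⟩
  rintro rfl
  have h' : lexLe (phiAut n (k + 1) (P + stdE n ((k + 1 : ℕ) : ℤ))) (phiAut n (k + 1) P) := h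
  have h2 : lexLe (phiAut n (k + 1) P) (phiAut n (k + 1) (P + stdE n ((k + 1 : ℕ) : ℤ))) := by
    apply lexLe_of_le
    rw [phi_add]
    exact le_add_of_nonneg_right (phi_e_nonneg n (k + 1) hk)
  have e := phi_inj n (k + 1) hk (lexLe_antisymm h' h2)
  have := congrFun e ⟨k, by omega⟩
  push_cast at this
  rw [Pi.add_apply, stdE_succ] at this
  simp at this

end

end St7

/-- `Z(z(P;k),…) = P − V_{k−1}`, `B(…) = P + V_{k−1}`,
`Z(z*(P;k),…) = P − V_k`, `B(z*(P;k),…) = P + V_k`; consequently for every distributive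
`D(ℤⁿ)`-filtration the S-terms `S^{p(P;k),z*(P;k)}_{b*(P;k),q(P;k)}` and
`S^{p(P;k+1),z(P;k+1)}_{b(P;k+1),q(P;k+1)}` are isomorphic for `0 ≤ k ≤ n−1`. -/
theorem statement7 (n : ℕ) (hn : 1 ≤ n) (k : ℕ) (hk : k ≤ n) (P : Fin n → ℤ) :
    Zset (zSec n k P) (qSec n k P) (pSec n k P) (bSec n k P) = (fun v => P - v) '' Vm n k ∧
    Bset (zSec n k P) (qSec n k P) (pSec n k P) (bSec n k P) = (fun v => P + v) '' Vm n k ∧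
    Zset (zsSec n k P) (qSec n k P) (pSec n k P) (bsSec n k P) =
      (fun v => P - v) '' Vm n (k + 1) ∧
    Bset (zsSec n k P) (qSec n k P) (pSec n k P) (bsSec n k P) =
      (fun v => P + v) '' Vm n (k + 1) ∧
    (∀ (C : Type) (_ : AddCommGroup C) (d : C →+ C), (∀ x : C, d (d x) = 0) →
      ∀ (F : LowerSet (Fin n → ℤ) → AddSubgroup C), Monotone F →
      (∀ a, ∀ x ∈ F a, d x ∈ F a) →
      (∀ a b, F (a ⊓ b) = F a ⊓ F b) → (∀ a b, F (a ⊔ b) = F a ⊔ F b) →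
      k + 1 ≤ n →
      ∀ (pL zL bL qL pL' zL' bL' qL' : LowerSet (Fin n → ℤ)),
        (pL : Set (Fin n → ℤ)) = pSec n k P → (zL : Set (Fin n → ℤ)) = zsSec n k P →
        (bL : Set (Fin n → ℤ)) = bsSec n k P → (qL : Set (Fin n → ℤ)) = qSec n k P →
        (pL' : Set (Fin n → ℤ)) = pSec n (k + 1) P →
        (zL' : Set (Fin n → ℤ)) = zSec n (k + 1) P →
        (bL' : Set (Fin n → ℤ)) = bSec n (k + 1) P →
        (qL' : Set (Fin n → ℤ)) = qSec n (k + 1) P →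
        Nonempty (Sterm d (F pL) (F zL) (F bL) (F qL) ≃+
          Sterm d (F pL') (F zL') (F bL') (F qL'))) := by
  refine ⟨St7.main_Z n k P hk, St7.main_B n k P hn hk, St7.main_Zs n k P hk,
    St7.main_Bs n k P hk, ?_⟩
  intro C _ d _ F hm hd hinf hsup hk1 p z b q p' z' b' q' hp hz hb hq hp' hz' hb' hq'
  have h0 : P ∈ (fun v => P - v) '' Vm n (k + 1) := ⟨0, St7.zero_mem_Vm n k, by simp⟩
  have h0' : P ∈ (fun v => P + v) '' Vm n (k + 1) := ⟨0, St7.zero_mem_Vm n k, by simp⟩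
  have hqp : ∀ j, qSec n j P ⊆ pSec n j P := fun j x hx => hx.1
  refine St7.sterm_iso d F hm hd hinf hsup p z b q p' z' b' q' ?_ ?_ ?_ ?_ ?_ ?_
    ((fun v => P - v) '' Vm n (k + 1)) ((fun v => P + v) '' Vm n (k + 1)) ?_ ?_ ?_ ?_ ?_ ?_ ?_ ?_
  · rw [← LowerSet.coe_subset_coe, hz, hp]
    exact fun x hx => St7.z_sub n k P hk hx.1
  · rw [← LowerSet.coe_subset_coe, hb, hp]; exact St7.p_sub_bs n k P hk
  · rw [← LowerSet.coe_subset_coe, hq, hp]; exact hqp k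
  · rw [← LowerSet.coe_subset_coe, hz', hp']; exact St7.z_sub n (k + 1) P hk1
  · rw [← LowerSet.coe_subset_coe, hb', hp']; exact St7.p_sub_b n k P hn hk1
  · rw [← LowerSet.coe_subset_coe, hq', hp']; exact hqp (k + 1)
  · rw [hz, hq, hp, hb]; exact St7.main_Zs n k P hk
  · rw [hz, hq, hp, hb]; exact St7.main_Bs n k P hk
  · rw [hz', hq', hp', hb']; exact St7.main_Z n (k + 1) P hk1
  · rw [hz', hq', hp', hb']; exact St7.main_B n (k + 1) P hn hk1
  · rw [hp, hq, St7.pq_eq]; exact Set.singleton_subset_iff.2 h0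
  · rw [hp, hq, St7.pq_eq]; exact Set.singleton_subset_iff.2 h0'
  · rw [hp', hq', St7.pq_eq]; exact Set.singleton_subset_iff.2 h0
  · rw [hp', hq', St7.pq_eq]; exact Set.singleton_subset_iff.2 h0'
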